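/- Fix k ≥ 1. There exists a constant C = C(k) such that for any finite set K ⊆ ℝ/ℤ, any η > 0, and any N ≥ 1, the Bohr set B(K, η) = {x ∈ ℤ : -N/2 ≤ x < N/2 and ‖αx‖ ≤ η for all α ∈ K} contains an arithmetic progression of length ≫_k η·N^{exp(-C|K|)} whose common difference is a perfect k-th power. -/

import Mathlib

open Finset

/-- Almost orthogonality: the second moment of a sum of `H` unimodular sequences is close to its
diagonal contribution when the pairwise correlations are small. -/
theorem abs_sum_norm_sq_sub_le (N H : ℕ) (g : ℕ → ℕ → ℂ) (hg : ∀ h n, ‖g h n‖ = 1) (δ : ℝ)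
    (hδ : 0 ≤ δ)
    (hcorr : ∀ h < H, ∀ h' < H, h ≠ h' →
      ‖∑ n ∈ range N, g h n * starRingEnd ℂ (g h' n)‖ ≤ δ) :
    |∑ n ∈ range N, ‖∑ h ∈ range H, g h n‖ ^ 2 - H * N| ≤ H ^ 2 * δ := by
  have key : ((∑ n ∈ range N, ‖∑ h ∈ range H, g h n‖ ^ 2 - H * N : ℝ) : ℂ) =
      ∑ h ∈ range H, ∑ h' ∈ range H,
        ((∑ n ∈ range N, g h n * starRingEnd ℂ (g h' n)) - if h = h' then (N : ℂ) else 0) := by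
    have hdiag : ∑ h ∈ range H, ∑ h' ∈ range H, (if h = h' then (N : ℂ) else 0) = H * N := by
      rw [sum_congr rfl fun h hh => by rw [sum_ite_eq, if_pos hh]]
      simp
    simp_rw [sum_sub_distrib]
    rw [hdiag]
    push_cast
    congr 1
    simp_rw [← Complex.mul_conj', map_sum, sum_mul_sum]
    rw [sum_comm]
    exact sum_congr rfl fun h _ => sum_comm
  rw [← Real.norm_eq_abs, ← Complex.norm_real, key]
  calc _ ≤ ∑ h ∈ range H, ∑ h' ∈ range H, δ := by
        refine norm_sum_le_of_le _ fun h hh => norm_sum_le_of_le _ fun h' hh' => ?_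
        split_ifs with heq
        · subst heq
          simpa [Complex.mul_conj', hg] using hδ
        · simpa using hcorr h (mem_range.1 hh) h' (mem_range.1 hh') heq
    _ = H ^ 2 * δ := by simp; ring

theorem four_mul_norm_le_norm_fourierChar_sub_one (x : ℝ) :
    4 * ‖(x : UnitAddCircle)‖ ≤ ‖(Real.fourierChar x : ℂ) - 1‖ := by
  have hper : (Real.fourierChar x : ℂ) =
      Complex.exp (Complex.I * ((2 * Real.pi * (x - round x) : ℝ) : ℂ)) := by
    rw [Real.fourierChar_apply, Complex.exp_eq_exp_iff_exists_int]
    exact ⟨round x, by push_cast; ring⟩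
  rw [hper, Complex.norm_exp_I_mul_ofReal_sub_one, UnitAddCircle.norm_eq, Real.norm_eq_abs, abs_mul]
  have hs := Real.mul_abs_le_abs_sin (x := 2 * Real.pi * (x - round x) / 2) (by
    have := abs_sub_round x
    rw [show 2 * Real.pi * (x - round x) / 2 = Real.pi * (x - round x) by ring, abs_mul,
      abs_of_pos Real.pi_pos]
    nlinarith [Real.pi_pos])
  have : 2 / Real.pi * |2 * Real.pi * (x - round x) / 2| = 2 * |x - round x| := by
    rw [show 2 * Real.pi * (x - round x) / 2 = Real.pi * (x - round x) by ring, abs_mul,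
      abs_of_pos Real.pi_pos]
    field_simp
  rw [this] at hs
  norm_num
  linarith

theorem norm_geom_sum_fourierChar_mul_le (x : ℝ) (N : ℕ) :
    ‖∑ n ∈ range N, (Real.fourierChar (n * x) : ℂ)‖ * ‖(x : UnitAddCircle)‖ ≤ 1 / 2 := by
  have hpow : ∀ n : ℕ, (Real.fourierChar (n * x) : ℂ) = (Real.fourierChar x : ℂ) ^ n := fun n => by
    rw [← nsmul_eq_mul, AddChar.map_nsmul_eq_pow, Circle.coe_pow]
  have h1 := geom_sum_mul (Real.fourierChar x : ℂ) N
  have h2 := congrArg norm h1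
  rw [norm_mul] at h2
  have h3 : ‖(Real.fourierChar x : ℂ) ^ N - 1‖ ≤ 2 := by
    refine (norm_sub_le _ _).trans ?_
    rw [norm_pow, Circle.norm_coe]; norm_num
  have h4 := four_mul_norm_le_norm_fourierChar_sub_one x
  simp_rw [hpow]
  have h5 := mul_le_mul_of_nonneg_left h4
    (norm_nonneg (∑ n ∈ range N, (Real.fourierChar x : ℂ) ^ n))
  linarith

theorem norm_sum_shift_sub_le (f : ℕ → ℂ) (hf : ∀ n, ‖f n‖ = 1) (N h : ℕ) :
    ‖∑ n ∈ range N, f (n + h) - ∑ n ∈ range N, f n‖ ≤ 2 * h := by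
  induction h with
  | zero => simp
  | succ h ih =>
    have h1 := sum_range_succ (fun n => f (n + h)) N
    rw [sum_range_succ'] at h1
    have h2 : ∑ n ∈ range N, f (n + (h + 1)) - ∑ n ∈ range N, f n =
        (∑ n ∈ range N, f (n + h) - ∑ n ∈ range N, f n) + (f (N + h) - f (0 + h)) := by
      have : ∀ n, n + (h + 1) = n + 1 + h := fun n => by ring
      simp_rw [this]
      linear_combination h1
    rw [h2]
    refine (norm_add_le _ _).trans ?_
    have h3 := norm_sub_le (f (N + h)) (f (0 + h))
    rw [hf, hf] at h3
    push_cast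
    linarith

/-- Van der Corput's inequality with short shifts: a unimodular sequence with a large exponential
sum correlates with one of its shifts. -/
theorem exists_large_correlation (f : ℕ → ℂ) (hf : ∀ n, ‖f n‖ = 1) {T : ℝ} (hT : 1 ≤ T) {N : ℕ}
    (hN : 36 * T ^ 3 < N) (hS : N ≤ T * ‖∑ n ∈ range N, f n‖) :
    ∃ h h' : ℕ, h ≠ h' ∧ h ≤ 9 * T ^ 2 ∧ h' ≤ 9 * T ^ 2 ∧
      N ≤ 8 * T ^ 2 * ‖∑ n ∈ range N, f (n + h) * starRingEnd ℂ (f (n + h'))‖ := by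
  have hT0 : 0 < T := by linarith
  set H := ⌈8 * T ^ 2⌉₊ with hHdef
  have hH1 : 8 * T ^ 2 ≤ H := Nat.le_ceil _
  have hH2 : (H : ℝ) ≤ 9 * T ^ 2 := by
    have := Nat.ceil_lt_add_one (a := 8 * T ^ 2) (by positivity)
    nlinarith
  have hH0 : (0 : ℝ) < H := by nlinarith
  by_contra! hcon
  have hcorr := abs_sum_norm_sq_sub_le N H (fun h n => f (n + h)) (fun h n => hf _)
    (N / (8 * T ^ 2)) (by positivity) (fun h hh h' hh' hne => by
      have hlt : (h : ℝ) ≤ H := by exact_mod_cast hh.le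
      have hlt' : (h' : ℝ) ≤ H := by exact_mod_cast hh'.le
      have := hcon h h' hne (hlt.trans hH2) (hlt'.trans hH2)
      rw [le_div_iff₀ (by positivity)]
      linarith)
  have hcs := sq_sum_le_card_mul_sum_sq (s := range N) (f := fun n => ‖∑ h ∈ range H, f (n + h)‖)
  rw [card_range] at hcs
  set V := ∑ n ∈ range N, ‖∑ h ∈ range H, f (n + h)‖
  set W := ∑ n ∈ range N, ‖∑ h ∈ range H, f (n + h)‖ ^ 2
  set S := ∑ n ∈ range N, f n
  have hV : V ≤ H * N / (2 * T) := by
    have hW : W ≤ H * N + H ^ 2 * (N / (8 * T ^ 2)) := by linarith [(abs_le.1 hcorr).2]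
    have hHN : (H * N : ℝ) ≤ H ^ 2 * (N / (8 * T ^ 2)) := by
      rw [mul_div_assoc', le_div_iff₀ (by positivity)]
      have : (0 : ℝ) ≤ H * N := by positivity
      nlinarith
    refine abs_le_of_sq_le_sq' (a := V) ?_ (by positivity) |>.2
    calc V ^ 2 ≤ N * W := hcs
      _ ≤ N * (2 * (H ^ 2 * (N / (8 * T ^ 2)))) := by gcongr; linarith
      _ = _ := by field_simp; ring
  have hHS : H * ‖S‖ ≤ V + H * (2 * H) := by
    have h1 : (H : ℂ) * S = ∑ n ∈ range N, ∑ h ∈ range H, f (n + h) -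
        ∑ h ∈ range H, (∑ n ∈ range N, f (n + h) - S) := by
      rw [sum_sub_distrib, sum_comm]; simp
    have h2 := congrArg norm h1
    rw [norm_mul, Complex.norm_natCast] at h2
    rw [h2]
    refine (norm_sub_le _ _).trans (add_le_add (norm_sum_le _ _) ?_)
    have h3 : ∀ h ∈ range H, ‖∑ n ∈ range N, f (n + h) - S‖ ≤ 2 * (H : ℝ) := fun h hh => by
      have hlt : (h : ℝ) ≤ H := by exact_mod_cast (mem_range.1 hh).le
      linarith [norm_sum_shift_sub_le f hf N h]
    exact (norm_sum_le_of_le _ h3).trans (by simp)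
  have h1 : ‖S‖ ≤ N / (2 * T) + 2 * H := by
    refine le_of_mul_le_mul_left (hHS.trans ?_) hH0
    rw [mul_add, mul_div_assoc']
    linarith
  have h2 : T * ‖S‖ ≤ T * (N / (2 * T) + 2 * H) := by gcongr
  have h3 : T * (N / (2 * T) + 2 * H) = N / 2 + 2 * (T * H) := by field_simp
  have h4 : T * H ≤ T * (9 * T ^ 2) := by gcongr
  nlinarith

theorem natDegree_and_coeff_taylor_sub (P : Polynomial ℝ) {k : ℕ} (hP : P.natDegree ≤ k + 1)
    (a b : ℝ) :
    (Polynomial.taylor a P - Polynomial.taylor b P).natDegree ≤ k ∧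
    (Polynomial.taylor a P - Polynomial.taylor b P).coeff k =
      (k + 1) * (a - b) * P.coeff (k + 1) := by
  have hd : (Polynomial.hasseDeriv k P).natDegree < 2 := by
    have := Polynomial.natDegree_hasseDeriv_le P k
    omega
  constructor
  · rw [Polynomial.natDegree_le_iff_coeff_eq_zero]
    intro n hn
    have hd' : (Polynomial.hasseDeriv n P).natDegree < 1 := by
      have := Polynomial.natDegree_hasseDeriv_le P n
      omega
    rw [Polynomial.coeff_sub, Polynomial.taylor_coeff, Polynomial.taylor_coeff,
      Polynomial.eval_eq_sum_range' hd', Polynomial.eval_eq_sum_range' hd']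
    simp
  · rw [Polynomial.coeff_sub, Polynomial.taylor_coeff, Polynomial.taylor_coeff,
      Polynomial.eval_eq_sum_range' hd, Polynomial.eval_eq_sum_range' hd]
    simp [sum_range_succ, Polynomial.hasseDeriv_coeff, add_comm 1 k]
    ring

theorem norm_unitAddCircle_le_half (x : UnitAddCircle) : ‖x‖ ≤ 1 / 2 := by
  simpa using AddCircle.norm_le_half_period 1 (x := x) one_ne_zero

theorem norm_natCast_mul_le (n : ℕ) (x : ℝ) :
    ‖((n * x : ℝ) : UnitAddCircle)‖ ≤ n * ‖(x : UnitAddCircle)‖ := by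
  rw [← nsmul_eq_mul, AddCircle.coe_nsmul]
  exact norm_nsmul_le

theorem fourierChar_mul_conj (x y : ℝ) :
    (Real.fourierChar x : ℂ) * starRingEnd ℂ (Real.fourierChar y : ℂ) =
      (Real.fourierChar (x - y) : ℂ) := by
  rw [← Circle.coe_inv_eq_conj, ← Circle.coe_mul, AddChar.map_sub_eq_div, div_eq_mul_inv]

/-- A form of Weyl's inequality: if a polynomial phase has a large exponential sum, then its leading
coefficient is close to a rational number with small denominator. -/
theorem exists_mul_coeff_near_int_of_large_sum (k : ℕ) :
    ∃ A : ℕ, 1 ≤ A ∧ ∀ P : Polynomial ℝ, P.natDegree ≤ k + 1 → ∀ T : ℝ, 1 ≤ T → ∀ N : ℕ,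
    N ≤ T * ‖∑ n ∈ range N, (Real.fourierChar (P.eval (n : ℝ)) : ℂ)‖ →
    ∃ r : ℕ, 1 ≤ r ∧ r ≤ A * T ^ A ∧
      ‖((r * P.coeff (k + 1) : ℝ) : UnitAddCircle)‖ * N ≤ A * T ^ A := by
  induction k with
  | zero =>
    refine ⟨1, le_rfl, fun P hP T hT N hS => ⟨1, le_rfl, by simpa using hT, ?_⟩⟩
    have hev : ∀ x : ℝ, (Real.fourierChar (P.eval x) : ℂ) =
        (Real.fourierChar (P.coeff 0) : ℂ) * (Real.fourierChar (x * P.coeff 1) : ℂ) := fun x => by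
      rw [← Circle.coe_mul, ← AddChar.map_add_eq_mul,
        Polynomial.eval_eq_sum_range' (show P.natDegree < 2 by omega)]
      simp [sum_range_succ, mul_comm]
    simp_rw [hev, ← mul_sum, norm_mul, Circle.norm_coe, one_mul] at hS
    have h1 := norm_geom_sum_fourierChar_mul_le (P.coeff 1) N
    have h2 := mul_le_mul_of_nonneg_right hS (norm_nonneg (P.coeff 1 : UnitAddCircle))
    simp only [zero_add, Nat.cast_one, one_mul, pow_one]
    nlinarith
  | succ k ih =>
    obtain ⟨A, hA1, hA⟩ := ih
    obtain ⟨B, hB⟩ : ∃ B : ℕ, B = 9 * (k + 2) * A * 8 ^ A + 2 * A + 36 := ⟨_, rfl⟩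
    refine ⟨B, by omega, fun P hP T hT N hS => ?_⟩
    have hT0 : 0 < T := by linarith
    have hTB : ∀ m ≤ B, T ^ m ≤ T ^ B := fun m hm => pow_le_pow_right₀ hT hm
    have hBpos : 36 ≤ (B : ℝ) := by exact_mod_cast (show 36 ≤ B by omega)
    rcases le_or_gt (N : ℝ) (36 * T ^ 3) with hN | hN
    · have h36 : 36 * T ^ 3 ≤ B * T ^ B := by
        have := hTB 3 (by omega)
        gcongr
      refine ⟨1, le_rfl, ?_, ?_⟩
      · have := one_le_pow₀ hT (n := B)
        push_cast
        nlinarith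
      · refine (mul_le_of_le_one_left N.cast_nonneg ?_).trans (hN.trans h36)
        exact (norm_unitAddCircle_le_half _).trans (by norm_num)
    · obtain ⟨a, b, hab, ha, hb, hcorr⟩ :=
        exists_large_correlation (fun n => (Real.fourierChar (P.eval (n : ℝ)) : ℂ))
          (fun n => Circle.norm_coe _) hT hN hS
      obtain ⟨hdeg, hcoeff⟩ := natDegree_and_coeff_taylor_sub P hP a b
      obtain ⟨r, hr1, hrA, hr⟩ := hA _ hdeg (8 * T ^ 2) (by nlinarith) N (by
        simpa only [fourierChar_mul_conj, Polynomial.eval_sub, Polynomial.taylor_eval,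
          Nat.cast_add] using hcorr)
      obtain ⟨d, hd⟩ : ∃ d : ℕ, d = ((a : ℤ) - b).natAbs := ⟨_, rfl⟩
      have hd1 : 1 ≤ d := by omega
      have hdab : d ≤ a ∨ d ≤ b := by omega
      have hd9 : (d : ℝ) ≤ 9 * T ^ 2 := by
        rcases hdab with h | h
        · exact (Nat.cast_le.2 h).trans ha
        · exact (Nat.cast_le.2 h).trans hb
      have hBT : 9 * (k + 2) * A * 8 ^ A * T ^ (2 * A + 2) ≤ B * T ^ B := by
        have h1 := hTB (2 * A + 2) (by omega)
        have h2 : (9 * (k + 2) * A * 8 ^ A : ℝ) ≤ B := by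
          exact_mod_cast (show 9 * (k + 2) * A * 8 ^ A ≤ B by omega)
        gcongr
      have hk : (0 : ℝ) ≤ k := k.cast_nonneg
      refine ⟨d * (k + 2) * r, Nat.mul_pos (Nat.mul_pos hd1 (by omega)) hr1, ?_, ?_⟩
      · push_cast
        calc (d * (k + 2) * r : ℝ) ≤ 9 * T ^ 2 * (k + 2) * (A * (8 * T ^ 2) ^ A) := by gcongr
          _ = 9 * (k + 2) * A * 8 ^ A * T ^ (2 * A + 2) := by ring
          _ ≤ _ := hBT
      · have hnorm : ‖(((d * (k + 2) * r : ℕ) * P.coeff (k + 1 + 1) : ℝ) : UnitAddCircle)‖ =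
            ‖((r * (Polynomial.taylor (a : ℝ) P - Polynomial.taylor (b : ℝ) P).coeff (k + 1) : ℝ)
              : UnitAddCircle)‖ := by
          rw [hcoeff]
          push_cast
          rcases Int.natAbs_eq ((a : ℤ) - b) with h | h
          · have h' : (a : ℝ) - b = d := by
              rw [← hd] at h
              simpa using congrArg (Int.cast : ℤ → ℝ) h
            rw [h']
            congr 2; ring
          · have h' : (a : ℝ) - b = -d := by
              rw [← hd] at h
              simpa using congrArg (Int.cast : ℤ → ℝ) h
            rw [h', ← norm_neg, ← AddCircle.coe_neg]
            congr 2; ring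
        rw [hnorm]
        refine hr.trans (le_trans ?_ hBT)
        rw [mul_pow, ← pow_mul, pow_add]
        have h1 : 0 ≤ A * (8 ^ A * T ^ (2 * A)) := by positivity
        have h2 : 1 ≤ 9 * (k + 2) * T ^ 2 := by nlinarith
        calc _ = A * (8 ^ A * T ^ (2 * A)) * 1 := by ring
          _ ≤ A * (8 ^ A * T ^ (2 * A)) * (9 * (k + 2) * T ^ 2) := by gcongr
          _ = _ := by ring

/-- A sequence that avoids a neighbourhood of `0` in `ℝ/ℤ` has a large low-frequency Fourier
coefficient. -/
theorem exists_large_fourier_coeff (x : ℕ → ℝ) {T : ℝ} (hT : 1 ≤ T) {N : ℕ} (hN : 0 < N)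
    (hx : ∀ n < N, 1 ≤ T * ‖(x n : UnitAddCircle)‖) :
    ∃ h : ℕ, 1 ≤ h ∧ h ≤ 2 * T ^ 2 ∧
      N ≤ 4 * T ^ 2 * ‖∑ n ∈ range N, (Real.fourierChar (h * x n) : ℂ)‖ := by
  have hT0 : 0 < T := by linarith
  have hN0 : (0 : ℝ) < N := by exact_mod_cast hN
  set H := ⌈T ^ 2⌉₊ with hHdef
  have hH1 : T ^ 2 ≤ H := Nat.le_ceil _
  have hH2 : (H : ℝ) ≤ 2 * T ^ 2 := by
    have := Nat.ceil_lt_add_one (a := T ^ 2) (by positivity)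
    nlinarith
  have hH0 : (0 : ℝ) < H := by nlinarith
  by_contra! hcon
  have hsymm : ∀ h : ℕ, ‖∑ n ∈ range N, (Real.fourierChar (-(h * x n)) : ℂ)‖ =
      ‖∑ n ∈ range N, (Real.fourierChar (h * x n) : ℂ)‖ := fun h => by
    rw [← Complex.norm_conj (∑ n ∈ range N, (Real.fourierChar (h * x n) : ℂ)), map_sum]
    simp_rw [AddChar.map_neg_eq_inv, Circle.coe_inv_eq_conj]
  have hcorr := abs_sum_norm_sq_sub_le N H (fun h n => (Real.fourierChar (h * x n) : ℂ))
    (fun h n => Circle.norm_coe _) (N / (4 * T ^ 2)) (by positivity) (fun h hh h' hh' hne => by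
      have hlt : (h : ℝ) ≤ H := by exact_mod_cast hh.le
      have hlt' : (h' : ℝ) ≤ H := by exact_mod_cast hh'.le
      simp_rw [fourierChar_mul_conj, ← sub_mul]
      rw [le_div_iff₀ (by positivity)]
      rcases lt_or_gt_of_ne hne with hl | hl
      · have := hcon (h' - h) (by omega) (by
          push_cast [hl.le]
          have : (0 : ℝ) ≤ h := h.cast_nonneg
          linarith)
        rw [← hsymm] at this
        push_cast [hl.le] at this
        simp_rw [← neg_mul, neg_sub] at this
        linarith
      · have := hcon (h - h') (by omega) (by
          push_cast [hl.le]
          have : (0 : ℝ) ≤ h' := h'.cast_nonneg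
          linarith)
        push_cast [hl.le] at this
        linarith)
  have hF : ∑ n ∈ range N, ‖∑ h ∈ range H, (Real.fourierChar (h * x n) : ℂ)‖ ^ 2 ≤
      N * (T / 2) ^ 2 := by
    refine (sum_le_sum (g := fun _ => (T / 2) ^ 2) fun n hn => ?_).trans (by simp)
    gcongr
    have h1 := norm_geom_sum_fourierChar_mul_le (x n) H
    have h2 := hx n (mem_range.1 hn)
    have h3 := mul_le_mul_of_nonneg_left h2
      (norm_nonneg (∑ h ∈ range H, (Real.fourierChar (h * x n) : ℂ)))
    nlinarith
  have h1 := (abs_le.1 hcorr).1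
  have h2 : (H : ℝ) ^ 2 * (N / (4 * T ^ 2)) ≤ H * N / 2 := by
    rw [mul_div_assoc', div_le_div_iff₀ (by positivity) (by norm_num)]
    have : (0 : ℝ) ≤ H * N := by positivity
    nlinarith
  have h3 : T ^ 2 * N ≤ H * N := by gcongr
  have h4 : 0 < T ^ 2 * N := by positivity
  nlinarith

/-- Recurrence of `k`-th powers for a single frequency, with polynomial bounds. -/
theorem exists_pow_norm_le (k : ℕ) (hk : 1 ≤ k) : ∃ A : ℕ, 1 ≤ A ∧ ∀ α T : ℝ, 1 ≤ T →
    ∃ q : ℕ, 1 ≤ q ∧ q ≤ A * T ^ A ∧ T * ‖((α * q ^ k : ℝ) : UnitAddCircle)‖ ≤ 1 := by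
  obtain ⟨j, rfl⟩ : ∃ j, k = j + 1 := ⟨k - 1, by omega⟩
  obtain ⟨A, hA1, hA⟩ := exists_mul_coeff_near_int_of_large_sum j
  obtain ⟨B, hB⟩ : ∃ B : ℕ, B = 2 * (2 * A * 4 ^ A) ^ (j + 1) + ((2 * A + 2) * (j + 1) + 1) :=
    ⟨_, rfl⟩
  refine ⟨B, by omega, fun α T hT => ?_⟩
  have hT0 : 0 < T := by linarith
  by_contra! hcon
  set M : ℝ := 2 * A * 4 ^ A * T ^ (2 * A + 2) with hM
  set U : ℝ := T * M ^ (j + 1) with hU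
  have hA1' : (1 : ℝ) ≤ A := by exact_mod_cast hA1
  have hM1 : 1 ≤ M := by
    have h1 : (1 : ℝ) ≤ 4 ^ A := one_le_pow₀ (by norm_num)
    have h2 : 1 ≤ T ^ (2 * A + 2) := one_le_pow₀ hT
    exact one_le_mul_of_one_le_of_one_le
      (one_le_mul_of_one_le_of_one_le (by linarith) h1) h2
  have hMU : M ≤ U := by
    have := le_self_pow₀ hM1 (Nat.succ_ne_zero j)
    exact this.trans (le_mul_of_one_le_left (by positivity) hT)
  have hUB : 2 * U ≤ B * T ^ B := by
    have h1 : (2 * (2 * A * 4 ^ A) ^ (j + 1) : ℝ) ≤ B := by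
      exact_mod_cast (show 2 * (2 * A * 4 ^ A) ^ (j + 1) ≤ B by omega)
    have h2 : T ^ ((2 * A + 2) * (j + 1) + 1) ≤ T ^ B := pow_le_pow_right₀ hT (by omega)
    calc 2 * U = 2 * (2 * A * 4 ^ A) ^ (j + 1) * T ^ ((2 * A + 2) * (j + 1) + 1) := by
          rw [hU, hM, mul_pow _ (T ^ (2 * A + 2)), ← pow_mul]; ring
      _ ≤ _ := by gcongr
  obtain ⟨N, hN⟩ : ∃ N : ℕ, N = ⌊B * T ^ B⌋₊ := ⟨_, rfl⟩
  have hN1 : (N : ℝ) ≤ B * T ^ B := hN ▸ Nat.floor_le (by positivity)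
  have hNU : U ≤ N := by
    have := Nat.lt_floor_add_one (B * T ^ B)
    rw [← hN] at this
    linarith
  have hN0 : (0 : ℝ) < N := by linarith
  obtain ⟨h, hh1, hh2, hS⟩ := exists_large_fourier_coeff
    (fun n => α * ((n + 1 : ℕ) : ℝ) ^ (j + 1)) hT (by exact_mod_cast hN0) (fun n hn => (hcon (n + 1) (by omega) (by
      exact (Nat.cast_le.2 (show n + 1 ≤ N from hn)).trans hN1)).le)
  have hmonic : ((Polynomial.X + Polynomial.C (1 : ℝ)) ^ (j + 1)).Monic :=
    (Polynomial.monic_X_add_C 1).pow _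
  have hdeg : ((Polynomial.X + Polynomial.C (1 : ℝ)) ^ (j + 1)).natDegree = j + 1 := by
    rw [(Polynomial.monic_X_add_C (1 : ℝ)).natDegree_pow, Polynomial.natDegree_X_add_C, mul_one]
  obtain ⟨r, hr1, hrA, hr⟩ := hA
    (Polynomial.C (h * α) * (Polynomial.X + Polynomial.C (1 : ℝ)) ^ (j + 1))
    ((Polynomial.natDegree_C_mul_le _ _).trans hdeg.le) (4 * T ^ 2) (by nlinarith) N (by
      simpa [mul_assoc] using hS)
  have hlead : ((Polynomial.X + Polynomial.C (1 : ℝ)) ^ (j + 1)).coeff (j + 1) = 1 := by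
    have := hmonic.coeff_natDegree
    rwa [hdeg] at this
  rw [Polynomial.coeff_C_mul, hlead, mul_one] at hr
  have hAM : A * (4 * T ^ 2) ^ A * (2 * T ^ 2) = M := by
    rw [hM, mul_pow, ← pow_mul, pow_add]; ring
  have hm : ((r * h : ℕ) : ℝ) ≤ M := by
    rw [← hAM]; push_cast; gcongr
  have hAM' : A * (4 * T ^ 2) ^ A ≤ M := by
    rw [← hAM]; exact le_mul_of_one_le_right (by positivity) (by nlinarith)
  have hbad := hcon (r * h) (Nat.mul_pos hr1 hh1) (by linarith)
  have hpow : ‖((α * (r * h : ℕ) ^ (j + 1) : ℝ) : UnitAddCircle)‖ ≤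
      M ^ j * ‖((r * (h * α) : ℝ) : UnitAddCircle)‖ := by
    have := norm_natCast_mul_le ((r * h) ^ j) (r * (h * α))
    rw [show ((((r * h) ^ j : ℕ) : ℝ) * (r * (h * α))) = α * (r * h : ℕ) ^ (j + 1) by
      push_cast; ring] at this
    refine this.trans ?_
    push_cast at hm ⊢
    gcongr
  have : N < (N : ℝ) := calc
    (N : ℝ) = 1 * N := (one_mul _).symm
    _ < T * ‖((α * (r * h : ℕ) ^ (j + 1) : ℝ) : UnitAddCircle)‖ * N := by gcongr
    _ ≤ T * (M ^ j * ‖((r * (h * α) : ℝ) : UnitAddCircle)‖) * N := by gcongr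
    _ = T * M ^ j * (‖((r * (h * α) : ℝ) : UnitAddCircle)‖ * N) := by ring
    _ ≤ T * M ^ j * M := by gcongr; exact hr.trans hAM'
    _ = U := by rw [hU]; ring
    _ ≤ N := hNU
  exact lt_irrefl _ this

/-- Simultaneous recurrence of `k`-th powers for a finite set of frequencies. -/
theorem exists_simultaneous_pow_norm_le (k : ℕ) (hk : 1 ≤ k) : ∃ A M : ℕ, 1 ≤ A ∧ 1 ≤ M ∧
    ∀ (K : Finset ℝ) (T s : ℝ), 1 ≤ T → ∃ q : ℕ, 1 ≤ q ∧ q ≤ (A * T) ^ M ^ #K ∧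
      ∀ α ∈ K, T * ‖((s * α * q ^ k : ℝ) : UnitAddCircle)‖ ≤ 1 := by
  obtain ⟨A, hA1, hA⟩ := exists_pow_norm_le k hk
  have hA1' : (1 : ℝ) ≤ A := by exact_mod_cast hA1
  refine ⟨A, k * A + A + 1, hA1, by omega, fun K T s hT => ?_⟩
  have hT0 : 0 < T := by linarith
  have hAT : 1 ≤ A * T := one_le_mul_of_one_le_of_one_le hA1' hT
  induction K using Finset.induction generalizing s with
  | empty => exact ⟨1, le_rfl, by simpa using hAT, by simp⟩
  | insert α K hα ih =>
    set M := k * A + A + 1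
    set B : ℝ := (A * T) ^ M ^ #K with hB
    have hB1 : 1 ≤ B := one_le_pow₀ hAT
    obtain ⟨q₁, hq₁, hq₁A, hq₁α⟩ := hA (s * α) (T * B ^ k)
      (one_le_mul_of_one_le_of_one_le hT (one_le_pow₀ hB1))
    obtain ⟨q₂, hq₂, hq₂B, hq₂K⟩ := ih (s * q₁ ^ k)
    refine ⟨q₂ * q₁, Nat.mul_pos hq₂ hq₁, ?_, fun β hβ => ?_⟩
    · rw [card_insert_of_notMem hα]
      push_cast
      have hAA : (A : ℝ) ≤ A ^ A := le_self_pow₀ hA1' (by omega)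
      calc (q₂ * q₁ : ℝ) ≤ B * (A * (T * B ^ k) ^ A) := by gcongr
        _ ≤ B * (A ^ A * (T * B ^ k) ^ A) := by gcongr
        _ = (A * T) ^ A * B ^ (k * A + 1) := by
          rw [mul_pow, mul_pow, ← pow_mul]; ring
        _ ≤ B ^ A * B ^ (k * A + 1) := by
          have : A * T ≤ B := le_self_pow₀ hAT (pow_ne_zero _ (by omega))
          gcongr
        _ = (A * T) ^ M ^ (#K + 1) := by
          rw [← pow_add, hB, ← pow_mul, pow_succ]
          congr 2; ring
    · rcases mem_insert.1 hβ with rfl | hβ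
      · have h1 := norm_natCast_mul_le (q₂ ^ k) (s * β * q₁ ^ k)
        rw [show (((q₂ ^ k : ℕ) : ℝ) * (s * β * q₁ ^ k)) = s * β * (q₂ * q₁ : ℕ) ^ k by
          push_cast; ring] at h1
        refine le_trans ?_ hq₁α
        rw [mul_assoc T]
        refine mul_le_mul_of_nonneg_left (h1.trans ?_) hT0.le
        push_cast
        gcongr
      · have := hq₂K β hβ
        rwa [show s * q₁ ^ k * β * q₂ ^ k = s * β * (q₂ * q₁ : ℕ) ^ k by push_cast; ring] at this


/-- Bohr sets contain long `k`-th power progressions: there are constants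
`C = C(k)` and `c = c(k) > 0` such that for every finite frequency set `K`,
every `η > 0` and every `N ≥ 1`, the Bohr set
`B(K, η) = {x ∈ [-N/2, N/2) : ‖αx‖ ≤ η ∀ α ∈ K}` contains an arithmetic
progression of length at least `c·η·N^{exp(-C|K|)}` whose common difference is a
perfect `k`-th power. -/
theorem bohr_set_kth_power_progression (k : ℕ) (hk : 1 ≤ k) :
    ∃ C c : ℝ, 0 < C ∧ 0 < c ∧
      ∀ (K : Finset ℝ) (η N : ℝ), 0 < η → η ≤ 1 → 1 ≤ N →
        ∃ (a : ℤ) (q : ℕ) (L : ℕ), 1 ≤ q ∧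
          c * η * N ^ Real.exp (-(C * K.card)) ≤ (2 * L + 1 : ℝ) ∧
          ∀ j : ℤ, |j| ≤ L →
            (-(N / 2) ≤ ((a + j * (q : ℤ) ^ k : ℤ) : ℝ) ∧
              ((a + j * (q : ℤ) ^ k : ℤ) : ℝ) < N / 2) ∧
            ∀ α ∈ K,
              |α * ((a + j * (q : ℤ) ^ k : ℤ) : ℝ) -
                (round (α * ((a + j * (q : ℤ) ^ k : ℤ) : ℝ)) : ℝ)| ≤ η := by
  obtain ⟨A, M, hA1, hM1, hAM⟩ := exists_simultaneous_pow_norm_le k hk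
  have hA1' : (1 : ℝ) ≤ A := by exact_mod_cast hA1
  have hM1' : (1 : ℝ) ≤ M := by exact_mod_cast hM1
  have hk1 : (1 : ℝ) ≤ k := by exact_mod_cast hk
  have hkM : 1 < ((k + 1) * M : ℝ) := by nlinarith
  refine ⟨Real.log ((k + 1) * M), 1 / (3 * A), Real.log_pos hkM, by positivity,
    fun K η N hη hη1 hN => ?_⟩
  have hN0 : 0 < N := by linarith
  set e := Real.exp (-(Real.log ((k + 1) * M) * #K)) with he
  have he1 : e ≤ 1 := Real.exp_le_one_iff.2 (by
    have := Real.log_pos hkM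
    have : (0 : ℝ) ≤ #K := Nat.cast_nonneg _
    nlinarith)
  have he0 : 0 < e := Real.exp_pos _
  set T := (N / 3) ^ e / A with hT
  have hN3 : N ^ e ≤ 3 * (A * T) := by
    have h3 : (3 : ℝ) ^ e ≤ 3 := Real.rpow_le_self_of_one_le (by norm_num) he1
    calc N ^ e = 3 ^ e * (N / 3) ^ e := by
          rw [← Real.mul_rpow (by norm_num) (by positivity)]; congr 1; ring
      _ ≤ 3 * (N / 3) ^ e := by gcongr
      _ = 3 * (A * T) := by rw [hT]; field_simp
  have hgoal : 1 / (3 * A) * η * N ^ e ≤ η * T := by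
    calc 1 / (3 * A) * η * N ^ e ≤ 1 / (3 * A) * η * (3 * (A * T)) := by gcongr
      _ = η * T := by field_simp
  rcases lt_or_ge T 1 with hT1 | hT1
  · refine ⟨0, 1, 0, le_rfl, ?_, fun j hj => ?_⟩
    · refine hgoal.trans ?_
      push_cast
      nlinarith
    · obtain rfl : j = 0 := by simpa using hj
      simp [hη.le]
      constructor <;> linarith
  have hAT : 1 ≤ A * T := one_le_mul_of_one_le_of_one_le hA1' hT1
  have hATN : A * T = (N / 3) ^ e := by rw [hT]; field_simp
  obtain ⟨q, hq1, hqT, hqK⟩ : ∃ q : ℕ, 1 ≤ q ∧ T * q ^ k ≤ N / 3 ∧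
      ∀ α ∈ K, T * ‖((α * q ^ k : ℝ) : UnitAddCircle)‖ ≤ 1 := by
    rcases K.eq_empty_or_nonempty with rfl | hK
    · refine ⟨1, le_rfl, ?_, by simp⟩
      have : e = 1 := by simp [he]
      rw [this, Real.rpow_one] at hATN
      rw [Nat.cast_one, one_pow, mul_one, ← hATN]
      exact le_mul_of_one_le_left (by linarith) hA1'
    · obtain ⟨q, hq1, hqM, hqK⟩ := hAM K T 1 hT1
      refine ⟨q, hq1, ?_, by simpa using hqK⟩
      have hcard : #K ≠ 0 := hK.card_pos.ne'
      have hexp : e * (((k + 1) * M) ^ #K : ℕ) = 1 := by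
        rw [he, Real.exp_neg, mul_comm (Real.log _), Real.exp_nat_mul,
          Real.exp_log (by positivity)]
        push_cast
        exact inv_mul_cancel₀ (by positivity)
      calc T * q ^ k ≤ (A * T) * ((A * T) ^ M ^ #K) ^ k := by
            gcongr
            exact le_mul_of_one_le_left (by linarith) hA1'
        _ ≤ (A * T) ^ M ^ #K * ((A * T) ^ M ^ #K) ^ k := by
            gcongr
            exact le_self_pow₀ hAT (pow_ne_zero _ (by omega))
        _ = (A * T) ^ ((k + 1) * M ^ #K) := by
            rw [← pow_succ', ← pow_mul]; congr 1; ring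
        _ ≤ (A * T) ^ (((k + 1) * M) ^ #K) := by
            refine pow_le_pow_right₀ hAT ?_
            rw [mul_pow]
            gcongr
            exact Nat.le_self_pow hcard _
        _ = N / 3 := by
            rw [hATN, ← Real.rpow_natCast, ← Real.rpow_mul (by positivity), hexp, Real.rpow_one]
  have hL := Nat.floor_le (show 0 ≤ η * T by positivity)
  refine ⟨0, q, ⌊η * T⌋₊, hq1, ?_, fun j hj => ?_⟩
  · have := Nat.lt_floor_add_one (η * T)
    have h0 : (0 : ℝ) ≤ ⌊η * T⌋₊ := Nat.cast_nonneg _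
    linarith
  have hjT : |(j : ℝ)| ≤ η * T := by
    have : ((|j| : ℤ) : ℝ) ≤ ((⌊η * T⌋₊ : ℤ) : ℝ) := Int.cast_le.2 hj
    push_cast at this
    exact this.trans hL
  have hjq : |(j : ℝ) * q ^ k| ≤ N / 3 := by
    rw [abs_mul, abs_of_nonneg (show (0 : ℝ) ≤ q ^ k by positivity)]
    refine le_trans ?_ hqT
    gcongr
    nlinarith
  refine ⟨?_, fun α hα => ?_⟩
  · push_cast
    obtain ⟨h1, h2⟩ := abs_le.1 hjq
    constructor <;> linarith
  · rw [← UnitAddCircle.norm_eq]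
    have h1 : ‖((α * ((0 + j * (q : ℤ) ^ k : ℤ) : ℝ) : ℝ) : UnitAddCircle)‖ ≤
        |(j : ℝ)| * ‖((α * q ^ k : ℝ) : UnitAddCircle)‖ := by
      rw [show α * ((0 + j * (q : ℤ) ^ k : ℤ) : ℝ) = j • (α * q ^ k : ℝ) by
        rw [zsmul_eq_mul]; push_cast; ring, AddCircle.coe_zsmul]
      simpa [Int.norm_eq_abs] using norm_zsmul_le j ((α * q ^ k : ℝ) : UnitAddCircle)
    refine h1.trans ?_
    calc _ ≤ η * T * ‖((α * q ^ k : ℝ) : UnitAddCircle)‖ := by gcongr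
      _ = η * (T * ‖((α * q ^ k : ℝ) : UnitAddCircle)‖) := by ring
      _ ≤ η * 1 := by gcongr; exact hqK α hα
      _ = η := mul_one _
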